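/- If α = (a_1, ..., a_n) is a zero-sum-free sequence of elements of an abelian group with n ≥ 1, then Σ(α_{n−1}) is a proper subset of Σ(α); consequently, every zero-sum-free sequence of length n satisfies |Σ(α)| ≥ n + 1. -/

import Mathlib

/-- The set of all subsequence sums of a list (including the sum 0 of the empty
subsequence). -/
def subSums {G : Type*} [AddCommMonoid G] [DecidableEq G] (l : List G) : Finset G :=
  (l.sublists.map List.sum).toFinset

/-- A sequence is zero-sum-free if no nonempty subsequence sums to zero. -/
def ZeroSumFree {G : Type*} [AddCommMonoid G] (l : List G) : Prop :=
  ∀ t : List G, t.Sublist l → t ≠ [] → t.sum ≠ 0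

theorem mem_subSums {G : Type*} [AddCommMonoid G] [DecidableEq G] {l : List G} {x : G} :
    x ∈ subSums l ↔ ∃ t : List G, t.Sublist l ∧ t.sum = x := by
  simp [subSums]

theorem List.Sublist.exists_sublist_sum_add_sum {G : Type*} [AddCommMonoid G] {t l : List G}
    (h : t.Sublist l) : ∃ s : List G, s.Sublist l ∧ t.sum + s.sum = l.sum := by
  induction h with
  | slnil => exact ⟨[], .slnil, by simp⟩
  | cons a _ ih =>
    obtain ⟨s, hs, hsum⟩ := ih
    exact ⟨a :: s, hs.cons_cons a, by rw [List.sum_cons, List.sum_cons, ← hsum, add_left_comm]⟩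
  | cons_cons a _ ih =>
    obtain ⟨s, hs, hsum⟩ := ih
    exact ⟨s, hs.cons a, by rw [List.sum_cons, List.sum_cons, ← hsum, add_assoc]⟩

theorem ZeroSumFree.sublist {G : Type*} [AddCommMonoid G] {l l' : List G}
    (h : ZeroSumFree l) (hl : l'.Sublist l) : ZeroSumFree l' :=
  fun t ht => h t (ht.trans hl)

theorem subSums_mono {G : Type*} [AddCommMonoid G] [DecidableEq G] {l l' : List G}
    (h : l'.Sublist l) : subSums l' ⊆ subSums l := by
  intro x hx
  obtain ⟨t, ht, rfl⟩ := mem_subSums.1 hx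
  exact mem_subSums.2 ⟨t, ht.trans h, rfl⟩

/-- The sum of all terms is a subsequence sum that needs the last term. -/
theorem ZeroSumFree.subSums_ssubset_append_singleton {G : Type*} [AddCommGroup G] [DecidableEq G]
    {l : List G} {a : G} (h : ZeroSumFree (l ++ [a])) : subSums l ⊂ subSums (l ++ [a]) := by
  refine (Finset.ssubset_iff_of_subset (subSums_mono (List.sublist_append_left l [a]))).2
    ⟨(l ++ [a]).sum, mem_subSums.2 ⟨_, List.Sublist.refl _, rfl⟩, fun hmem => ?_⟩
  obtain ⟨t, ht, hsum⟩ := mem_subSums.1 hmem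
  obtain ⟨s, hs, hts⟩ := ht.exists_sublist_sum_add_sum
  refine h (s ++ [a]) (hs.append (List.Sublist.refl [a])) (by simp) ?_
  rw [List.sum_append, ← hts, add_assoc, ← List.sum_append] at hsum
  exact left_eq_add.1 hsum

theorem ZeroSumFree.length_lt_card_subSums {G : Type*} [AddCommGroup G] [DecidableEq G]
    {l : List G} (h : ZeroSumFree l) : l.length < (subSums l).card := by
  induction l using List.reverseRecOn with
  | nil => simp [subSums]
  | append_singleton l a ih =>
    have hlt := Finset.card_lt_card h.subSums_ssubset_append_singleton
    have hl := ih (h.sublist (List.sublist_append_left l [a]))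
    rw [List.length_append, List.length_singleton]
    omega

/-- If `α` is a zero-sum-free sequence of length `n ≥ 1`, then `Σ(α_{n-1})` is a proper
subset of `Σ(α)`; consequently `|Σ(α)| ≥ n + 1`. -/
theorem subSums_dropLast_ssubset {G : Type*} [AddCommGroup G] [DecidableEq G]
    (l : List G) (hl : l ≠ []) (hzsf : ZeroSumFree l) :
    subSums l.dropLast ⊂ subSums l ∧ l.length + 1 ≤ (subSums l).card := by
  refine ⟨?_, hzsf.length_lt_card_subSums⟩
  have happ := List.dropLast_append_getLast hl
  rw [← happ] at hzsf
  have hss := hzsf.subSums_ssubset_append_singleton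
  rwa [happ] at hss
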